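/- (Theorem 2) Let f : ℝ^K → ℝ be smooth and satisfy the Bernstein bound with band B > 0 and height H > 0, i.e., |∂^α f(y)| ≤ B^{|α|} H for every multi-index α and every y ∈ ℝ^K. Let x be a random vector whose K coordinates are independent Gaussian random variables with mean 0 and variance σ², and let T_n f be the degree-n Taylor polynomial of f at 0. Then E[ |f(x) − T_n f(x)|² ] < ((√2 · K · B · σ)^{n+1} · H)² / (n+1)!. -/

import Mathlib

open MeasureTheory

/-- Single partial derivative in coordinate direction `k`. -/
noncomputable def pderiv1 {K : ℕ} (k : Fin K) (f : (Fin K → ℝ) → ℝ) : (Fin K → ℝ) → ℝ :=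
  fun x => fderiv ℝ f x (Pi.single k 1)

/-- Mixed partial derivative `∂^α f` for a multi-index `α : Fin K → ℕ`. -/
noncomputable def mpderiv {K : ℕ} (α : Fin K → ℕ) (f : (Fin K → ℝ) → ℝ) :
    (Fin K → ℝ) → ℝ :=
  (List.finRange K).foldr (fun k g => (pderiv1 k)^[α k] g) f

/-- Degree-`n` Taylor polynomial of `f` at `0`:
`T_n f(x) = Σ_{|α| ≤ n} (∂^α f(0) / α!) x^α`. -/
noncomputable def taylorPoly {K : ℕ} (n : ℕ) (f : (Fin K → ℝ) → ℝ) (x : Fin K → ℝ) : ℝ :=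
  ∑ β : Fin K → Fin (n + 1), if (∑ k, (β k : ℕ)) ≤ n then
    (mpderiv (fun k => (β k : ℕ)) f 0 / ∏ k, ((β k : ℕ).factorial : ℝ)) *
      ∏ k, x k ^ (β k : ℕ)
  else 0

/-- Smooth functions. -/
def SmoothFn (K : ℕ) : Submodule ℝ ((Fin K → ℝ) → ℝ) where
  carrier := {f | ContDiff ℝ (⊤ : ℕ∞) f}
  add_mem' := by
    intro f g hf hg
    simp only [Set.mem_ofPred_eq] at *
    exact ContDiff.add hf hg
  zero_mem' := by
    simp only [Set.mem_ofPred_eq]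
    exact contDiff_const
  smul_mem' := by
    intro c f hf
    simp only [Set.mem_ofPred_eq] at *
    exact contDiff_const.smul hf

lemma contDiff_dirDeriv {K : ℕ} {f : (Fin K → ℝ) → ℝ} (hf : ContDiff ℝ (⊤ : ℕ∞) f)
    (v : Fin K → ℝ) : ContDiff ℝ (⊤ : ℕ∞) (fun x => fderiv ℝ f x v) :=
  (hf.fderiv_right (by simp)).clm_apply contDiff_const

lemma smoothFn_diff {K : ℕ} (f : SmoothFn K) : Differentiable ℝ f.1 :=
  ContDiff.differentiable (n := ((⊤ : ℕ∞) : WithTop ℕ∞)) f.2 (by simp)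

/-- Directional derivative operator. -/
noncomputable def dirOp {K : ℕ} (v : Fin K → ℝ) : Module.End ℝ (SmoothFn K) where
  toFun f := ⟨fun x => fderiv ℝ f.1 x v, contDiff_dirDeriv f.2 v⟩
  map_add' f g := by
    ext x
    change fderiv ℝ (f.1 + g.1) x v = fderiv ℝ f.1 x v + fderiv ℝ g.1 x v
    rw [fderiv_add (smoothFn_diff f x) (smoothFn_diff g x)]; rfl
  map_smul' c f := by
    ext x
    change fderiv ℝ (c • f.1) x v = c * fderiv ℝ f.1 x v
    rw [fderiv_const_smul (smoothFn_diff f x)]; rfl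

lemma dirOp_commute {K : ℕ} (v w : Fin K → ℝ) : Commute (dirOp v) (dirOp w) := by
  refine LinearMap.ext fun f => Subtype.ext (funext fun x => ?_)
  change fderiv ℝ (fun y => fderiv ℝ f.1 y w) x v = fderiv ℝ (fun y => fderiv ℝ f.1 y v) x w
  have hf : ContDiff ℝ (⊤ : ℕ∞) f.1 := f.2
  have hd : DifferentiableAt ℝ (fderiv ℝ f.1) x :=
    ((hf.fderiv_right (m := ((⊤ : ℕ∞) : WithTop ℕ∞)) (by simp)).differentiable (by simp)) x
  have hs : IsSymmSndFDerivAt ℝ f.1 x := hf.contDiffAt.isSymmSndFDerivAt (by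
    rw [minSmoothness_of_isRCLikeNormedField]; exact WithTop.coe_le_coe.2 le_top)
  have key : ∀ a b : Fin K → ℝ, fderiv ℝ (fun y => fderiv ℝ f.1 y a) x b
      = fderiv ℝ (fderiv ℝ f.1) x b a := by
    intro a b
    rw [fderiv_clm_apply hd (differentiableAt_const a)]
    simp
  rw [key, key]
  exact hs v w

lemma dirOp_eq_sum {K : ℕ} (v : Fin K → ℝ) :
    dirOp v = ∑ k, v k • dirOp (K := K) (Pi.single k 1) := by
  refine LinearMap.ext fun f => Subtype.ext (funext fun x => ?_)
  have h : v = ∑ k, v k • (Pi.single k 1 : Fin K → ℝ) := by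
    ext j; simp [Finset.sum_apply, Pi.single_apply]
  have h2 : ((∑ k, v k • dirOp (K := K) (Pi.single k 1)) f).1 x
      = ∑ k, v k • fderiv ℝ f.1 x (Pi.single k 1) := by
    simp [LinearMap.sum_apply, Finset.sum_apply]; rfl
  rw [h2]
  change fderiv ℝ f.1 x v = _
  conv_lhs => rw [h]
  simp only [map_sum, map_smul]

lemma dirOp_pow_single {K : ℕ} (k : Fin K) (m : ℕ) (f : SmoothFn K) :
    ((dirOp (Pi.single k 1) ^ m) f).1 = (pderiv1 k)^[m] f.1 := by
  induction m with
  | zero => rfl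
  | succ m ih =>
    rw [pow_succ', Function.iterate_succ_apply', ← ih]; rfl

lemma foldr_op {K : ℕ} (α : Fin K → ℕ) (f : SmoothFn K) (l : List (Fin K)) :
    (((l.map fun k => dirOp (K := K) (Pi.single k 1) ^ α k).prod) f).1
      = l.foldr (fun k g => (pderiv1 k)^[α k] g) f.1 := by
  induction l with
  | nil => rfl
  | cons a l ih =>
    rw [List.map_cons, List.prod_cons, List.foldr_cons, ← ih, ← dirOp_pow_single]; rfl

lemma dirOp_pow_apply {K : ℕ} (v : Fin K → ℝ) (m : ℕ) (f : SmoothFn K) (y : Fin K → ℝ) :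
    ((dirOp v ^ m) f).1 y = ∑ α ∈ Finset.piAntidiag Finset.univ m,
      (Nat.multinomial Finset.univ α : ℝ) * ((∏ k, v k ^ α k) * mpderiv α f.1 y) := by
  have hc : ((Finset.univ : Finset (Fin K)) : Set (Fin K)).Pairwise
      (Function.onFun Commute fun k => v k • dirOp (K := K) (Pi.single k 1)) :=
    fun a _ b _ _ => ((dirOp_commute _ _).smul_left _).smul_right _
  rw [dirOp_eq_sum, Finset.sum_pow_eq_sum_piAntidiag_of_commute _ _ hc]
  rw [LinearMap.sum_apply, AddSubmonoidClass.coe_finsetSum, Finset.sum_apply]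
  refine Finset.sum_congr rfl fun α _ => ?_
  have hp : ∀ h, Finset.noncommProd (Finset.univ : Finset (Fin K))
      (fun k => (v k • dirOp (K := K) (Pi.single k 1)) ^ α k) h
      = (∏ k, v k ^ α k) • (((List.finRange K).map
          fun k => dirOp (K := K) (Pi.single k 1) ^ α k).prod) := by
    intro h
    have h1 : Finset.noncommProd (Finset.univ : Finset (Fin K))
      (fun k => (v k • dirOp (K := K) (Pi.single k 1)) ^ α k) h
      = ((List.finRange K).map (fun k => (v k • dirOp (K := K) (Pi.single k 1)) ^ α k)).prod := by
      rw [← Finset.noncommProd_toFinset (List.finRange K) _ (by simpa using h)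
        (List.nodup_finRange K)]
      congr 1
      simp
    rw [h1, ← List.prod_ofFn, List.ofFn_eq_map]
    generalize List.finRange K = l
    induction l with
    | nil => simp
    | cons a l ih =>
      rw [List.map_cons, List.prod_cons, ih, List.map_cons, List.prod_cons, List.map_cons,
        List.prod_cons, smul_pow, smul_mul_smul_comm]
  rw [hp]
  have := foldr_op α f (List.finRange K)
  rw [Module.End.mul_apply, LinearMap.smul_apply, Module.End.natCast_apply]
  rw [show mpderiv α f.1 = _ from this.symm]
  simp [nsmul_eq_mul]

lemma iteratedDeriv_line {K : ℕ} (f : SmoothFn K) (x : Fin K → ℝ) (m : ℕ) :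
    iteratedDeriv m (fun t : ℝ => f.1 (t • x)) = fun t => ((dirOp x ^ m) f).1 (t • x) := by
  induction m with
  | zero => simp
  | succ m ih =>
    rw [iteratedDeriv_succ, ih]
    funext t
    rw [pow_succ']
    change _ = fderiv ℝ ((dirOp x ^ m) f).1 (t • x) x
    have h1 : HasDerivAt (fun t : ℝ => t • x) x t := by
      simpa using (hasDerivAt_id t).smul_const x
    exact ((smoothFn_diff ((dirOp x ^ m) f) (t • x)).hasFDerivAt.comp_hasDerivAt t h1).deriv

lemma dirOp_pow_bound {K : ℕ} (f : SmoothFn K) (B H : ℝ)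
    (hBern : ∀ (α : Fin K → ℕ) (y : Fin K → ℝ),
      |mpderiv α f.1 y| ≤ B ^ (∑ k, α k) * H) (x : Fin K → ℝ) (m : ℕ) (y : Fin K → ℝ) :
    |((dirOp x ^ m) f).1 y| ≤ (∑ k, |x k|) ^ m * (B ^ m * H) := by
  rw [dirOp_pow_apply, Finset.sum_pow_eq_sum_piAntidiag, Finset.sum_mul]
  refine (Finset.abs_sum_le_sum_abs _ _).trans (Finset.sum_le_sum fun α hα => ?_)
  have hs : ∑ k, α k = m := (Finset.mem_piAntidiag.1 hα).1
  rw [abs_mul, abs_mul, Finset.abs_prod, Nat.abs_cast, mul_assoc]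
  simp_rw [abs_pow]
  have := hBern α y
  rw [hs] at this
  gcongr

lemma taylorPoly_eq {K : ℕ} (n : ℕ) (f : SmoothFn K) (x : Fin K → ℝ) :
    taylorPoly n f.1 x =
      ∑ m ∈ Finset.range (n + 1), ((m.factorial : ℝ)⁻¹) * ((dirOp x ^ m) f).1 0 := by
  have h1 : ∀ m, ((m.factorial : ℝ)⁻¹) * ((dirOp x ^ m) f).1 0 =
      ∑ α ∈ Finset.piAntidiag (Finset.univ : Finset (Fin K)) m,
        (mpderiv α f.1 0 / ∏ k, ((α k).factorial : ℝ)) * ∏ k, x k ^ α k := by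
    intro m
    rw [dirOp_pow_apply, Finset.mul_sum]
    refine Finset.sum_congr rfl fun α hα => ?_
    have hs : ∑ k, α k = m := (Finset.mem_piAntidiag.1 hα).1
    have hm := Nat.multinomial_spec Finset.univ α
    rw [hs] at hm
    have hm' : (∏ k, ((α k).factorial : ℝ)) * (Nat.multinomial Finset.univ α : ℝ)
        = (m.factorial : ℝ) := by exact_mod_cast hm
    have hp : (∏ k, ((α k).factorial : ℝ)) ≠ 0 :=
      Finset.prod_ne_zero_iff.2 fun k _ => by positivity
    have hf : (m.factorial : ℝ) ≠ 0 := by positivity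
    field_simp
    rw [← hm']
    ring
  simp_rw [h1]
  rw [Finset.sum_sigma', taylorPoly, ← Finset.sum_filter]
  refine Finset.sum_bij (fun β _ => ⟨∑ k, (β k : ℕ), fun k => (β k : ℕ)⟩) ?_ ?_ ?_ ?_
  · intro β hβ
    have := (Finset.mem_filter.1 hβ).2
    exact Finset.mem_sigma.2 ⟨Finset.mem_range.2 (by change ∑ k, (β k : ℕ) < n + 1; omega),
      Finset.mem_piAntidiag.2 ⟨rfl, fun _ _ => Finset.mem_univ _⟩⟩
  · intro β _ γ _ h
    simp only [Sigma.mk.injEq, heq_eq_eq] at h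
    funext k
    exact Fin.ext (congrFun h.2 k)
  · rintro ⟨m, α⟩ h
    simp only [Finset.mem_sigma, Finset.mem_range, Finset.mem_piAntidiag] at h
    obtain ⟨hm, hs, -⟩ := h
    change ∑ k, α k = m at hs
    have hle : ∀ k, α k < n + 1 := fun k => by
      have : α k ≤ ∑ k, α k := Finset.single_le_sum (fun _ _ => Nat.zero_le _) (Finset.mem_univ k)
      omega
    refine ⟨fun k => ⟨α k, hle k⟩, ?_, ?_⟩
    · simp only [Finset.mem_filter, Finset.mem_univ, true_and]
      change ∑ k, α k ≤ n
      omega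
    · subst hs; rfl
  · intro β _
    rfl

lemma remainder_bound {K n : ℕ} (f : SmoothFn K) (B H : ℝ)
    (hBern : ∀ (α : Fin K → ℕ) (y : Fin K → ℝ),
      |mpderiv α f.1 y| ≤ B ^ (∑ k, α k) * H) (x : Fin K → ℝ) :
    |f.1 x - taylorPoly n f.1 x| ≤
      (∑ k, |x k|) ^ (n + 1) * (B ^ (n + 1) * H) / ((n + 1).factorial : ℝ) := by
  set g : ℝ → ℝ := fun t => f.1 (t • x) with hg
  have hf : ContDiff ℝ (⊤ : ℕ∞) f.1 := f.2
  have hgc : ContDiff ℝ (⊤ : ℕ∞) g := hf.comp (contDiff_id.smul contDiff_const)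
  have hgm : ∀ m : ℕ, ContDiff ℝ m g := fun m => hgc.of_le (by exact_mod_cast le_top)
  have hu : UniqueDiffOn ℝ (Set.uIcc (0 : ℝ) 1) := by
    rw [Set.uIcc_of_le zero_le_one]; exact uniqueDiffOn_Icc zero_lt_one
  have hw : ∀ (m : ℕ) (t : ℝ), t ∈ Set.uIcc (0 : ℝ) 1 →
      iteratedDerivWithin m g (Set.uIcc 0 1) t = ((dirOp x ^ m) f).1 (t • x) := by
    intro m t ht
    rw [iteratedDerivWithin_eq_iteratedDeriv hu (hgm m).contDiffAt ht, hg, iteratedDeriv_line]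
  have hsub : Set.uIoo (0 : ℝ) 1 ⊆ Set.uIcc 0 1 := Set.uIoo_subset_uIcc_self
  obtain ⟨t, ht, he⟩ := taylor_mean_remainder_lagrange (f := g) (x := 1) (x₀ := 0) (n := n)
    zero_ne_one (hgm n).contDiffOn (by
      have : DifferentiableOn ℝ (fun t : ℝ => ((dirOp x ^ n) f).1 (t • x)) (Set.uIoo 0 1) :=
        ((smoothFn_diff ((dirOp x ^ n) f)).comp
          (differentiable_id.smul_const x)).differentiableOn
      exact this.congr fun t ht => hw n t (hsub ht))
  have h0 : taylorWithinEval g n (Set.uIcc 0 1) 0 1 = taylorPoly n f.1 x := by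
    rw [taylor_within_apply, taylorPoly_eq]
    refine Finset.sum_congr rfl fun m _ => ?_
    rw [hw m 0 Set.left_mem_uIcc]
    simp
  have hg1 : g 1 = f.1 x := by simp [hg]
  rw [h0, hg1, hw _ t (hsub ht)] at he
  rw [he, sub_zero, one_pow, mul_one, abs_div, Nat.abs_cast]
  gcongr
  exact dirOp_pow_bound f B H hBern x (n + 1) _

lemma gauss_moment (σ : ℝ) (hσ : 0 < σ) (v : NNReal) (hvs : (v : ℝ) = σ ^ 2) (N : ℕ) :
    ∫ x, x ^ (2 * N) ∂(ProbabilityTheory.gaussianReal 0 v)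
      = σ ^ (2 * N) * ((2 * N - 1 : ℕ).doubleFactorial : ℝ) := by
  have hv : v ≠ 0 := by
    rintro rfl
    simp only [NNReal.coe_zero] at hvs
    exact (pow_pos hσ 2).ne hvs
  rw [ProbabilityTheory.integral_gaussianReal_eq_integral_smul hv]
  simp only [ProbabilityTheory.gaussianPDFReal, smul_eq_mul, sub_zero, hvs]
  have h0 : ∀ x : ℝ, (√(2 * Real.pi * σ ^ 2))⁻¹ * Real.exp (-x ^ 2 / (2 * σ ^ 2)) * x ^ (2 * N)
      = (fun t : ℝ => (√(2 * Real.pi * σ ^ 2))⁻¹ *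
          (t ^ ((2 * N : ℕ) : ℝ) * Real.exp (-(1 / (2 * σ ^ 2)) * t ^ (2 : ℝ)))) |x| := by
    intro x
    simp only [Real.rpow_natCast, Real.rpow_two, sq_abs, pow_mul]
    rw [show -x ^ 2 / (2 * σ ^ 2) = -(1 / (2 * σ ^ 2)) * x ^ 2 by ring]
    ring
  rw [integral_congr_ae (Filter.Eventually.of_forall h0),
    integral_comp_abs (f := fun t : ℝ => (√(2 * Real.pi * σ ^ 2))⁻¹ *
      (t ^ ((2 * N : ℕ) : ℝ) * Real.exp (-(1 / (2 * σ ^ 2)) * t ^ (2 : ℝ)))), integral_const_mul,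
    integral_rpow_mul_exp_neg_mul_rpow (by norm_num) (by
      have : (0 : ℝ) ≤ ((2 * N : ℕ) : ℝ) := by positivity
      linarith) (by positivity)]
  have e1 : (((2 * N : ℕ) : ℝ) + 1) / 2 = (N : ℝ) + 1 / 2 := by push_cast; ring
  rw [neg_div, e1, Real.Gamma_nat_add_half]
  have e2 : (1 / (2 * σ ^ 2)) ^ (-((N : ℝ) + 1 / 2)) = (2 * σ ^ 2) ^ N * (√2 * σ) := by
    rw [one_div, Real.inv_rpow (by positivity), Real.rpow_neg (by positivity), inv_inv,
      Real.rpow_add (by positivity), Real.rpow_natCast, ← Real.sqrt_eq_rpow,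
      Real.sqrt_mul (by norm_num), Real.sqrt_sq hσ.le]
  have e3 : √(2 * Real.pi * σ ^ 2) = √2 * √Real.pi * σ := by
    rw [Real.sqrt_mul (by positivity), Real.sqrt_sq hσ.le, Real.sqrt_mul (by norm_num)]
  rw [e2, e3, mul_pow, ← pow_mul]
  have : √Real.pi ≠ 0 := by positivity
  field_simp

lemma dfact_lt (n : ℕ) : (2 * (n + 1) - 1).doubleFactorial < 2 ^ (n + 1) * (n + 1).factorial := by
  induction n with
  | zero => decide
  | succ n ih =>
    have : 2 * (n + 1 + 1) - 1 = (2 * (n + 1) - 1) + 2 := by omega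
    rw [this, Nat.doubleFactorial_add_two, Nat.factorial_succ (n + 1), pow_succ]
    have h : 2 * (n + 1) - 1 + 2 ≤ 2 * (n + 1 + 1) := by omega
    calc _ < (2 * (n + 1) - 1 + 2) * (2 ^ (n + 1) * (n + 1).factorial) := by
          apply Nat.mul_lt_mul_of_pos_left ih (by omega)
      _ ≤ (2 * (n + 1 + 1)) * (2 ^ (n + 1) * (n + 1).factorial) := Nat.mul_le_mul_right _ h
      _ = _ := by ring

lemma final_bound {K n : ℕ} (hK : 0 < K)
    (F : (Fin K → ℝ) → ℝ) (B H σ : ℝ) (hB : 0 < B) (hH : 0 < H) (hσ : 0 < σ)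
    (v : NNReal) (hvs : (v : ℝ) = σ ^ 2)
    (hF : ∀ x, |F x| ≤ (∑ k, |x k|) ^ (n + 1) * (B ^ (n + 1) * H) / ((n + 1).factorial : ℝ)) :
    (∫ x : Fin K → ℝ, (F x) ^ 2
        ∂(Measure.pi fun _ : Fin K =>
          ProbabilityTheory.gaussianReal 0 v))
      < ((Real.sqrt 2 * K * B * σ) ^ (n + 1) * H) ^ 2 / ((n + 1).factorial : ℝ) := by
  set C : ℝ := (B ^ (n + 1) * H / ((n + 1).factorial : ℝ)) ^ 2 * (K : ℝ) ^ (2 * n + 1) with hC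
  have hgint : Integrable (fun t : ℝ => t ^ (2 * (n + 1)))
      (ProbabilityTheory.gaussianReal 0 v) := by
    have := (ProbabilityTheory.memLp_id_gaussianReal (μ := 0) (v := v)
      ((2 * (n + 1) : ℕ) : NNReal)).integrable_norm_pow'
    simpa [pow_mul] using this
  have hb : ∀ x : Fin K → ℝ, F x ^ 2 ≤ C * ∑ k, x k ^ (2 * (n + 1)) := by
    intro x
    have h1 : (∑ k, |x k|) ^ (2 * n + 1 + 1) ≤
        (K : ℝ) ^ (2 * n + 1) * ∑ k, |x k| ^ (2 * n + 1 + 1) := by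
      simpa using pow_sum_le_card_mul_sum_pow (s := Finset.univ) (f := fun k => |x k|)
        (fun i _ => abs_nonneg _) (2 * n + 1)
    have h2 : ∀ k, |x k| ^ (2 * n + 1 + 1) = x k ^ (2 * (n + 1)) := by
      intro k
      rw [show 2 * n + 1 + 1 = 2 * (n + 1) by ring, pow_mul, sq_abs, ← pow_mul]
    simp_rw [h2] at h1
    calc F x ^ 2 = |F x| ^ 2 := (sq_abs _).symm
      _ ≤ ((∑ k, |x k|) ^ (n + 1) * (B ^ (n + 1) * H) / ((n + 1).factorial : ℝ)) ^ 2 := by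
          gcongr; exact hF x
      _ = (B ^ (n + 1) * H / ((n + 1).factorial : ℝ)) ^ 2 * (∑ k, |x k|) ^ (2 * n + 1 + 1) := by
          ring
      _ ≤ (B ^ (n + 1) * H / ((n + 1).factorial : ℝ)) ^ 2 *
          ((K : ℝ) ^ (2 * n + 1) * ∑ k, x k ^ (2 * (n + 1))) := by gcongr
      _ = _ := by rw [hC]; ring
  have hik : ∀ k : Fin K, Integrable (fun x : Fin K → ℝ => x k ^ (2 * (n + 1)))
      (Measure.pi fun _ : Fin K =>
          ProbabilityTheory.gaussianReal 0 v) := fun k =>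
    integrable_comp_eval (μ := fun _ : Fin K =>
          ProbabilityTheory.gaussianReal 0 v) (i := k) hgint
  have hle : (∫ x : Fin K → ℝ, (F x) ^ 2
        ∂(Measure.pi fun _ : Fin K =>
          ProbabilityTheory.gaussianReal 0 v)) ≤
      ∫ x : Fin K → ℝ, C * ∑ k, x k ^ (2 * (n + 1))
        ∂(Measure.pi fun _ : Fin K =>
          ProbabilityTheory.gaussianReal 0 v) := by
    refine integral_mono_of_nonneg (Filter.Eventually.of_forall fun x => sq_nonneg _) ?_
      (Filter.Eventually.of_forall hb)
    exact (integrable_finsetSum _ fun k _ => hik k).const_mul C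
  refine hle.trans_lt ?_
  rw [integral_const_mul, integral_finsetSum _ fun k _ => hik k]
  have hk : ∀ k : Fin K, (∫ x : Fin K → ℝ, x k ^ (2 * (n + 1)) ∂(Measure.pi fun _ : Fin K =>
          ProbabilityTheory.gaussianReal 0 v)) =
          σ ^ (2 * (n + 1)) * ((2 * (n + 1) - 1 : ℕ).doubleFactorial : ℝ) := by
    intro k
    rw [← gauss_moment σ hσ v hvs (n + 1)]
    exact integral_comp_eval (μ := fun _ : Fin K =>
          ProbabilityTheory.gaussianReal 0 v) (i := k)
          (f := fun t : ℝ => t ^ (2 * (n + 1))) hgint.aestronglyMeasurable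
  simp_rw [hk]
  rw [Finset.sum_const, Finset.card_univ, Fintype.card_fin, nsmul_eq_mul]
  have hd : ((2 * (n + 1) - 1 : ℕ).doubleFactorial : ℝ) < 2 ^ (n + 1) * ((n + 1).factorial : ℝ) := by
    exact_mod_cast dfact_lt n
  have hK' : (0 : ℝ) < K := by exact_mod_cast hK
  have hC0 : 0 < C := by positivity
  calc C * (K * (σ ^ (2 * (n + 1)) * ((2 * (n + 1) - 1 : ℕ).doubleFactorial : ℝ)))
      < C * (K * (σ ^ (2 * (n + 1)) * (2 ^ (n + 1) * ((n + 1).factorial : ℝ)))) := by gcongr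
    _ = _ := by
      have hs : (√2 * K * B * σ) ^ (n + 1) * ((√2 * K * B * σ) ^ (n + 1)) =
          2 ^ (n + 1) * (K * B * σ) ^ (2 * (n + 1)) := by
        rw [← mul_pow, pow_mul, ← mul_pow]
        congr 1
        have : √2 * √2 = (2 : ℝ) := Real.mul_self_sqrt (by norm_num)
        linear_combination (K * B * σ) ^ 2 * this
      rw [mul_pow, sq ((√2 * K * B * σ) ^ (n + 1)), hs, hC]
      field_simp
      ring

/-- **Theorem 2.**  If `f : ℝ^K → ℝ` is smooth and satisfies the Bernstein bound
`|∂^α f(y)| ≤ B^{|α|} H` for every multi-index `α` and every `y`, and `x` has `K`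
independent Gaussian coordinates of mean `0` and variance `σ²`, then
`E[|f(x) − T_n f(x)|²] < ((√2 K B σ)^{n+1} H)² / (n+1)!`. -/
theorem mean_expected_risk_bound_gaussian {K n : ℕ} (hK : 0 < K)
    (f : (Fin K → ℝ) → ℝ) (B H σ : ℝ) (hB : 0 < B) (hH : 0 < H) (hσ : 0 < σ)
    (hf : ContDiff ℝ (⊤ : ℕ∞) f)
    (hBern : ∀ (α : Fin K → ℕ) (y : Fin K → ℝ),
      |mpderiv α f y| ≤ B ^ (∑ k, α k) * H) :
    (∫ x : Fin K → ℝ, (f x - taylorPoly n f x) ^ 2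
        ∂(Measure.pi fun _ : Fin K =>
          ProbabilityTheory.gaussianReal 0 ⟨σ ^ 2, sq_nonneg σ⟩))
      < ((Real.sqrt 2 * K * B * σ) ^ (n + 1) * H) ^ 2 / ((n + 1).factorial : ℝ) := by
  exact final_bound hK (fun x => f x - taylorPoly n f x) B H σ hB hH hσ ⟨σ ^ 2, sq_nonneg σ⟩ rfl
    (remainder_bound (⟨f, hf⟩ : SmoothFn K) B H hBern)
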